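/- arXiv:2504.01360 — 3 statements merged into one kernel-verified Lean document; each statement's English description precedes it below -/
import Mathlib

section
/- The persistence pairing procedure (Algorithm 2) applied to a finite real sequence y = (y_0, ..., y_m) produces at least #Y^m − 2 persistence pairs; each local maximum knot not lying in {x_0, x_max} is paired with exactly one local minimum knot, each local minimum knot that is not the global minimum knot occurs in exactly one persistence pair, and the global minimum knot remains unpaired. -/
/-- `x_l` is a (left-sided) local minimum knot of the sequence `y 0, …, y m`. -/
def IsLocalMinKnot (m : ℕ) (y : ℕ → ℝ) (l : ℕ) : Prop :=
  (l = 0 ∧ ∃ ν : ℕ, ν + 1 ≤ m ∧ (∀ i ≤ ν, y i = y 0) ∧ y 0 < y (ν + 1)) ∨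
  (0 < l ∧ l < m ∧ y (l - 1) > y l ∧
    ∃ ν : ℕ, l + ν + 1 ≤ m ∧ (∀ i, l ≤ i → i ≤ l + ν → y i = y l) ∧ y l < y (l + ν + 1)) ∨
  (l = m ∧ 0 < m ∧ y (m - 1) > y m)

/-- `x_l` is a (left-sided) local maximum knot of the sequence `y 0, …, y m`. -/
def IsLocalMaxKnot (m : ℕ) (y : ℕ → ℝ) (l : ℕ) : Prop :=
  (l = 0 ∧ ∃ ν : ℕ, ν + 1 ≤ m ∧ (∀ i ≤ ν, y i = y 0) ∧ y 0 > y (ν + 1)) ∨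
  (0 < l ∧ l < m ∧ y (l - 1) < y l ∧
    ∃ ν : ℕ, l + ν + 1 ≤ m ∧ (∀ i, l ≤ i → i ≤ l + ν → y i = y l) ∧ y l > y (l + ν + 1)) ∨
  (l = m ∧ 0 < m ∧ y (m - 1) < y m)

open Classical in
/-- The list of local minimum knots, in increasing index order. -/
noncomputable def minKnotList (m : ℕ) (y : ℕ → ℝ) : List ℕ :=
  (List.range (m + 1)).filter fun l => decide (IsLocalMinKnot m y l)

open Classical in
/-- The list of local maximum knots, in increasing index order. -/
noncomputable def maxKnotList (m : ℕ) (y : ℕ → ℝ) : List ℕ :=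
  (List.range (m + 1)).filter fun l => decide (IsLocalMaxKnot m y l)

open Classical in
/-- Local maximum knots sorted by increasing value, ties broken by smaller index. -/
noncomputable def sortedMaxKnots (m : ℕ) (y : ℕ → ℝ) : List ℕ :=
  (maxKnotList m y).mergeSort fun a b => decide (y a < y b ∨ (y a = y b ∧ a ≤ b))

/-- `I_max`: the extremum knot of highest index (`0` if there is no extremum knot). -/
noncomputable def imaxKnot (m : ℕ) (y : ℕ → ℝ) : ℕ :=
  ((minKnotList m y ++ maxKnotList m y).max?).getD 0

open Classical in
/-- One step of the persistence pairing algorithm (Algorithm 2): process the local maximum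
knot `k`, pairing it with the neighbouring remaining local minimum knot whose value is
closer (ties broken by the larger knot), and remove that minimum from the remaining list. -/
noncomputable def pairStep (y : ℕ → ℝ) (imax : ℕ)
    (acc : List (ℕ × ℕ) × List ℕ) (k : ℕ) : List (ℕ × ℕ) × List ℕ :=
  if k = 0 ∨ k = imax then acc
  else
    match (acc.2.filter fun j => decide (j < k)).max?,
          (acc.2.filter fun j => decide (k < j)).min? with
    | none, none => acc
    | some a, none => ((a, k) :: acc.1, acc.2.erase a)
    | none, some b => ((k, b) :: acc.1, acc.2.erase b)
    | some a, some b =>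
        if |y k - y a| < |y k - y b| then ((a, k) :: acc.1, acc.2.erase a)
        else ((k, b) :: acc.1, acc.2.erase b)

/-- The multiset `P₁` of persistence pairs of `y` produced by Algorithm 2,
as a list of pairs of knots (each pair ordered by knot index). -/
noncomputable def pairsP1 (m : ℕ) (y : ℕ → ℝ) : List (ℕ × ℕ) :=
  ((sortedMaxKnots m y).foldl (pairStep y (imaxKnot m y)) ([], minKnotList m y)).1

/-- The persistence distance `‖y‖_per`: the sum of the distances of function values over all
persistence pairs in `P₁` (pairs of `y`) and `P₂` (pairs of `-y`). -/
noncomputable def perDist (m : ℕ) (y : ℕ → ℝ) : ℝ :=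
  ((pairsP1 m y).map fun p => |y p.2 - y p.1|).sum +
  ((pairsP1 m fun i => -(y i)).map fun p => |y p.2 - y p.1|).sum

/-- The discrete total variation `TV(y) = ∑_{j=0}^{m-1} |y_{j+1} - y_j|`. -/
noncomputable def discreteTV (m : ℕ) (y : ℕ → ℝ) : ℝ :=
  ∑ j ∈ Finset.range m, |y (j + 1) - y j|

/-- The range `max_{0 ≤ j,k ≤ m} |y_j - y_k|` of the sequence `y 0, …, y m`. -/
noncomputable def seqRange (m : ℕ) (y : ℕ → ℝ) : ℝ :=
  ((Finset.range (m + 1)) ×ˢ (Finset.range (m + 1))).sup'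
    (Finset.Nonempty.product ⟨0, Finset.mem_range.mpr (Nat.succ_pos m)⟩
      ⟨0, Finset.mem_range.mpr (Nat.succ_pos m)⟩)
    fun p => |y p.1 - y p.2|

theorem isLocalMinKnot_iff (m : ℕ) (y : ℕ → ℝ) (l : ℕ) :
    IsLocalMinKnot m y l ↔ l ≤ m ∧ 0 < m ∧ (0 < l → y l < y (l - 1)) ∧
      (l < m → ∃ q, l < q ∧ q ≤ m ∧ (∀ i, l ≤ i → i < q → y i = y l) ∧ y l < y q) := by
  constructor
  · rintro (⟨rfl, ν, h1, h2, h3⟩ | ⟨h0, hm, h1, ν, h2, h3, h4⟩ | ⟨rfl, h0, h1⟩)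
    · exact ⟨by omega, by omega, by omega,
        fun _ => ⟨ν + 1, by omega, h1, fun i _ hi => h2 i (by omega), h3⟩⟩
    · exact ⟨by omega, by omega, fun _ => h1,
        fun _ => ⟨l + ν + 1, by omega, h2, fun i hi hi' => h3 i hi (by omega), h4⟩⟩
    · exact ⟨le_rfl, h0, fun _ => h1, fun h => absurd h (lt_irrefl _)⟩
  · rintro ⟨hl, hm, hd, hu⟩
    rcases Nat.eq_zero_or_pos l with rfl | h0
    · obtain ⟨q, h1, h2, h3, h4⟩ := hu hm
      obtain ⟨ν, rfl⟩ : ∃ ν, q = ν + 1 := ⟨q - 1, by omega⟩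
      exact Or.inl ⟨rfl, ν, h2, fun i hi => h3 i (by omega) (by omega), h4⟩
    · rcases hl.lt_or_eq with hlm | rfl
      · obtain ⟨q, h1, h2, h3, h4⟩ := hu hlm
        obtain ⟨ν, rfl⟩ : ∃ ν, q = l + ν + 1 := ⟨q - l - 1, by omega⟩
        exact Or.inr (Or.inl ⟨h0, hlm, hd h0, ν, h2,
          fun i hi hi' => h3 i hi (by omega), h4⟩)
      · exact Or.inr (Or.inr ⟨rfl, hm, hd h0⟩)

theorem isLocalMinKnot_neg (m : ℕ) (y : ℕ → ℝ) (l : ℕ) :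
    IsLocalMinKnot m (fun i => -y i) l ↔ IsLocalMaxKnot m y l := by
  simp [IsLocalMinKnot, IsLocalMaxKnot]

theorem isLocalMaxKnot_neg (m : ℕ) (y : ℕ → ℝ) (l : ℕ) :
    IsLocalMaxKnot m (fun i => -y i) l ↔ IsLocalMinKnot m y l := by
  simp [IsLocalMinKnot, IsLocalMaxKnot]

theorem isLocalMaxKnot_iff (m : ℕ) (y : ℕ → ℝ) (l : ℕ) :
    IsLocalMaxKnot m y l ↔ l ≤ m ∧ 0 < m ∧ (0 < l → y (l - 1) < y l) ∧
      (l < m → ∃ q, l < q ∧ q ≤ m ∧ (∀ i, l ≤ i → i < q → y i = y l) ∧ y q < y l) := by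
  rw [← isLocalMinKnot_neg, isLocalMinKnot_iff]
  simp

/-- A strict drop below the right end of an interval produces a local minimum knot in it, provided
the left end is either the first knot or lies above the drop. -/
theorem exists_isLocalMinKnot {m : ℕ} {y : ℕ → ℝ} {i j p : ℕ} (hip : i ≤ p) (hpj : p ≤ j)
    (hj : j ≤ m) (hp : y p < y j) (hi : i = 0 ∨ y p < y i) :
    ∃ l, i ≤ l ∧ l < j ∧ IsLocalMinKnot m y l ∧ y l ≤ y p := by
  classical
  obtain ⟨t, ht, htmin⟩ := Finset.exists_min_image (Finset.Icc i j) y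
    ⟨p, Finset.mem_Icc.2 ⟨hip, hpj⟩⟩
  have hex : ∃ l, i ≤ l ∧ l ≤ j ∧ ∀ s, i ≤ s → s ≤ j → y l ≤ y s :=
    ⟨t, (Finset.mem_Icc.1 ht).1, (Finset.mem_Icc.1 ht).2,
      fun s h1 h2 => htmin s (Finset.mem_Icc.2 ⟨h1, h2⟩)⟩
  obtain ⟨hil, hlj, hmin⟩ := Nat.find_spec hex
  have hfirst := fun n (hn : n < Nat.find hex) => Nat.find_min hex hn
  generalize Nat.find hex = l at *
  have hlp : y l ≤ y p := hmin p hip hpj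
  have hlj' : l < j := lt_of_le_of_ne hlj (by rintro rfl; linarith)
  refine ⟨l, hil, hlj', (isLocalMinKnot_iff m y l).2 ⟨by omega, by omega, fun h0 => ?_, fun _ => ?_⟩,
    hlp⟩
  · have hil' : i < l := lt_of_le_of_ne hil (by rintro rfl; rcases hi with h | h <;> [omega; linarith])
    by_contra hcon
    exact hfirst (l - 1) (by omega) ⟨by omega, by omega,
      fun s h1 h2 => (not_lt.1 hcon).trans (hmin s h1 h2)⟩
  · have hq : ∃ q, l < q ∧ q ≤ j ∧ y q ≠ y l := ⟨j, hlj', le_rfl, by linarith [hlp, hp] |> ne_of_gt⟩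
    obtain ⟨h1, h2, h3⟩ := Nat.find_spec hq
    have hbefore := fun n (hn : n < Nat.find hq) => Nat.find_min hq hn
    generalize Nat.find hq = q at *
    refine ⟨q, h1, h2.trans hj, fun s hs hsq => ?_, lt_of_le_of_ne (hmin q (by omega) h2) h3.symm⟩
    rcases hs.lt_or_eq with hs | rfl
    · by_contra hne
      exact hbefore s hsq ⟨hs, by omega, hne⟩
    · rfl

theorem exists_isLocalMinKnot_between {m : ℕ} {y : ℕ → ℝ} {i j p : ℕ} (hip : i ≤ p) (hpj : p ≤ j)
    (hj : j ≤ m) (hp : y p < y j) (hi : y p < y i) :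
    ∃ l, i < l ∧ l < j ∧ IsLocalMinKnot m y l := by
  obtain ⟨l, h1, h2, h3, h4⟩ := exists_isLocalMinKnot hip hpj hj hp (Or.inr hi)
  exact ⟨l, lt_of_le_of_ne h1 (by rintro rfl; linarith), h2, h3⟩

theorem exists_isLocalMinKnot_between_max {m : ℕ} {y : ℕ → ℝ} {i j : ℕ} (hij : i < j)
    (hi : IsLocalMaxKnot m y i) (hj : IsLocalMaxKnot m y j) :
    ∃ l, i < l ∧ l < j ∧ IsLocalMinKnot m y l := by
  rw [isLocalMaxKnot_iff] at hi hj
  obtain ⟨hjm, -, hjl, -⟩ := hj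
  obtain ⟨-, -, -, hir⟩ := hi
  obtain ⟨q, h1, h2, h3, h4⟩ := hir (by omega)
  have hjl := hjl (by omega)
  have hqj : q ≤ j := by
    by_contra hcon
    rw [h3 j (by omega) (by omega), h3 (j - 1) (by omega) (by omega)] at hjl
    exact lt_irrefl _ hjl
  rcases le_or_gt (y i) (y j) with h | h
  · exact exists_isLocalMinKnot_between h1.le hqj hjm (by linarith) h4
  · exact exists_isLocalMinKnot_between (p := j - 1) (by omega) (by omega) hjm hjl (by linarith)

theorem exists_isLocalMaxKnot_between_min {m : ℕ} {y : ℕ → ℝ} {i j : ℕ} (hij : i < j)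
    (hi : IsLocalMinKnot m y i) (hj : IsLocalMinKnot m y j) :
    ∃ l, i < l ∧ l < j ∧ IsLocalMaxKnot m y l := by
  rw [← isLocalMaxKnot_neg] at hi hj
  simpa only [isLocalMinKnot_neg] using exists_isLocalMinKnot_between_max hij hi hj

theorem IsLocalMaxKnot.not_isLocalMinKnot {m : ℕ} {y : ℕ → ℝ} {l : ℕ} (h : IsLocalMaxKnot m y l) :
    ¬ IsLocalMinKnot m y l := by
  intro h'
  rw [isLocalMaxKnot_iff] at h
  rw [isLocalMinKnot_iff] at h'
  obtain ⟨h1, h2, h3, h4⟩ := h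
  obtain ⟨-, -, h3', h4'⟩ := h'
  rcases Nat.eq_zero_or_pos l with rfl | h0
  · obtain ⟨q, hq, -, hc, hlt⟩ := h4 h2
    obtain ⟨q', hq', -, hc', hlt'⟩ := h4' h2
    rcases lt_trichotomy q q' with hqq | rfl | hqq
    · linarith [hc' q (by omega) hqq]
    · linarith
    · linarith [hc q' (by omega) hqq]
  · linarith [h3 h0, h3' h0]

theorem IsLocalMinKnot.le_of_forall_not_between {m : ℕ} {y : ℕ → ℝ} {a k : ℕ}
    (ha : IsLocalMinKnot m y a) (hk : IsLocalMaxKnot m y k)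
    (h : ∀ c, IsLocalMinKnot m y c → ¬ (a < c ∧ c < k) ∧ ¬ (k < c ∧ c < a)) : y a ≤ y k := by
  by_contra! hlt
  rw [isLocalMaxKnot_iff] at hk
  rw [isLocalMinKnot_iff] at ha
  obtain ⟨hk1, hk2, hk3, hk4⟩ := hk
  rcases lt_trichotomy a k with hak | rfl | hak
  · have := hk3 (by omega)
    obtain ⟨l, h1, h2, h3⟩ := exists_isLocalMinKnot_between (i := a) (j := k) (p := k - 1)
      (by omega) (by omega) hk1 this (by linarith)
    exact (h l h3).1 ⟨h1, h2⟩
  · exact lt_irrefl _ hlt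
  · obtain ⟨q, hq1, hq2, hq3, hq4⟩ := hk4 (by omega)
    have hqa : q ≤ a := by
      by_contra hcon
      linarith [hq3 a (by omega) (by omega)]
    obtain ⟨l, h1, h2, h3⟩ := exists_isLocalMinKnot_between (i := k) (j := a) (p := q)
      (by omega) (by omega) ha.1 (by linarith) hq4
    exact (h l h3).2 ⟨h1, h2⟩

/-- The peaks `T` and the valleys `R` alternate, starting and ending with a valley, and every peak
lies above its neighbouring valleys. -/
structure Interlaced (y : ℕ → ℝ) (T R : Set ℕ) : Prop where
  notMem : ∀ k ∈ T, k ∉ R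
  exists_lt : ∀ k ∈ T, ∃ a ∈ R, a < k
  exists_gt : ∀ k ∈ T, ∃ b ∈ R, k < b
  peak_between : ∀ a ∈ R, ∀ b ∈ R, a < b → ∃ k ∈ T, a < k ∧ k < b
  valley_between : ∀ k ∈ T, ∀ l ∈ T, k < l → ∃ a ∈ R, k < a ∧ a < l
  le : ∀ a ∈ R, ∀ k ∈ T, (∀ c ∈ R, ¬ (a < c ∧ c < k) ∧ ¬ (k < c ∧ c < a)) → y a ≤ y k

theorem Interlaced.diff {y : ℕ → ℝ} {T R : Set ℕ} (h : Interlaced y T R) {k a b x : ℕ}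
    (hk : k ∈ T) (hlow : ∀ l ∈ T, y k ≤ y l) (ha : a ∈ R) (hak : a < k) (hb : b ∈ R) (hkb : k < b)
    (ha' : ∀ c ∈ R, c < k → c ≤ a) (hb' : ∀ c ∈ R, k < c → b ≤ c) (hx : x = a ∨ x = b) :
    Interlaced y (T \ {k}) (R \ {x}) := by
  obtain ⟨h1, h2, h3, h4, h5, h6⟩ := h
  have hya : y a ≤ y k := h6 a ha k hk (by grind)
  have hyb : y b ≤ y k := h6 b hb k hk (by grind)
  have hl : ∀ l ∈ T, l < k → l < a := fun l hl hlk => by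
    obtain ⟨c, hc, hlc, hck⟩ := h5 l hl k hk hlk
    exact hlc.trans_le (ha' c hc hck)
  have hr : ∀ l ∈ T, k < l → b < l := fun l hl hkl => by
    obtain ⟨c, hc, hkc, hcl⟩ := h5 k hk l hl hkl
    exact (hb' c hc hkc).trans_lt hcl
  constructor
  · grind
  · rintro l ⟨hl1, hl2⟩
    rcases lt_or_gt_of_ne (show l ≠ k from hl2) with hlk | hlk
    · obtain ⟨c, hc, hcl⟩ := h2 l hl1
      exact ⟨c, by grind, hcl⟩
    · grind
  · rintro l ⟨hl1, hl2⟩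
    rcases lt_or_gt_of_ne (show l ≠ k from hl2) with hlk | hlk
    · grind
    · obtain ⟨c, hc, hcl⟩ := h3 l hl1
      exact ⟨c, by grind, hcl⟩
  · rintro u ⟨hu, hux⟩ v ⟨hv, hvx⟩ huv
    obtain ⟨l, hl1, hl2, hl3⟩ := h4 u hu v hv huv
    by_cases hlk : l = k
    · subst hlk
      rcases hx with rfl | rfl
      · obtain ⟨l', _⟩ := h4 u hu x ha (by grind)
        exact ⟨l', by grind⟩
      · obtain ⟨l', _⟩ := h4 x hb v hv (by grind)
        exact ⟨l', by grind⟩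
    · exact ⟨l, by grind⟩
  · rintro u ⟨hu, huk⟩ v ⟨hv, hvk⟩ huv
    obtain ⟨c, hc, hc1, hc2⟩ := h5 u hu v hv huv
    by_cases hcx : c = x
    · rcases hx with rfl | rfl
      · exact ⟨b, by grind⟩
      · exact ⟨a, by grind⟩
    · exact ⟨c, by grind⟩
  · rintro u ⟨hu, hux⟩ l ⟨hl1, hlk⟩ hc
    by_cases hadj : ∀ c ∈ R, ¬ (u < c ∧ c < l) ∧ ¬ (l < c ∧ c < u)
    · exact h6 u hu l hl1 hadj
    · have hxadj : (u < x ∧ x < l) ∨ (l < x ∧ x < u) := by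
        push Not at hadj
        obtain ⟨c, hcR, hc'⟩ := hadj
        obtain rfl : c = x := by
          by_contra hne
          have h7 := hc c ⟨hcR, hne⟩
          have h8 := hc' (by omega)
          omega
        omega
      have hule : u = a ∨ u = b := by
        rcases hx with rfl | rfl
        · have := hc b (by grind)
          grind
        · have := hc a (by grind)
          grind
      have := hlow l hl1
      rcases hule with rfl | rfl <;> linarith

theorem exists_max?_filter_lt {R : List ℕ} {k : ℕ} (h : ∃ a ∈ R, a < k) :
    ∃ a, (R.filter fun j => decide (j < k)).max? = some a ∧ a ∈ R ∧ a < k ∧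
      ∀ c ∈ R, c < k → c ≤ a := by
  obtain ⟨a, ha, hak⟩ := h
  cases hm : (R.filter fun j => decide (j < k)).max? with
  | none =>
    rw [List.max?_eq_none_iff] at hm
    simpa [hm] using (show a ∈ R.filter fun j => decide (j < k) by simp [ha, hak])
  | some b =>
    rw [List.max?_eq_some_iff] at hm
    simp only [List.mem_filter, decide_eq_true_eq] at hm
    exact ⟨b, rfl, hm.1.1, hm.1.2, fun c hc hck => hm.2 c ⟨hc, hck⟩⟩

theorem exists_min?_filter_gt {R : List ℕ} {k : ℕ} (h : ∃ a ∈ R, k < a) :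
    ∃ b, (R.filter fun j => decide (k < j)).min? = some b ∧ b ∈ R ∧ k < b ∧
      ∀ c ∈ R, k < c → b ≤ c := by
  obtain ⟨a, ha, hak⟩ := h
  cases hm : (R.filter fun j => decide (k < j)).min? with
  | none =>
    rw [List.min?_eq_none_iff] at hm
    simpa [hm] using (show a ∈ R.filter fun j => decide (k < j) by simp [ha, hak])
  | some b =>
    rw [List.min?_eq_some_iff] at hm
    simp only [List.mem_filter, decide_eq_true_eq] at hm
    exact ⟨b, rfl, hm.1.1, hm.1.2, fun c hc hck => hm.2 c ⟨hc, hck⟩⟩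

/-- A step of the algorithm on an interlaced configuration whose lowest peak is `k` pairs `k` with a
neighbouring valley other than the global minimum `g`. -/
theorem pairStep_of_interlaced {y : ℕ → ℝ} {imax k g : ℕ} {T : Set ℕ} {P : List (ℕ × ℕ)}
    {R : List ℕ} (hk0 : k ≠ 0) (hki : k ≠ imax) (hR : R.Nodup) (hkT : k ∈ T)
    (hlow : ∀ l ∈ T, y k ≤ y l) (h : Interlaced y T {a | a ∈ R}) (hgle : ∀ a ∈ R, y g ≤ y a)
    (hglt : ∀ a ∈ R, a < g → y g < y a) :
    ∃ x ∈ R, x ≠ g ∧ Interlaced y (T \ {k}) {a | a ∈ R.erase x} ∧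
      ∃ p : ℕ × ℕ, (p = (x, k) ∨ p = (k, x)) ∧ pairStep y imax (P, R) k = (p :: P, R.erase x) := by
  obtain ⟨a, hamax, ha, hak, ha'⟩ := exists_max?_filter_lt (h.exists_lt k hkT)
  obtain ⟨b, hbmin, hb, hkb, hb'⟩ := exists_min?_filter_gt (h.exists_gt k hkT)
  have hya : y a ≤ y k := h.le a ha k hkT fun c hc => by
    have := ha' c hc
    omega
  have hyb : y b ≤ y k := h.le b hb k hkT fun c hc => by
    have := hb' c hc
    omega
  have herase (x : ℕ) : {c | c ∈ R.erase x} = {c | c ∈ R} \ {x} := by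
    ext c
    simp [hR.mem_erase_iff, and_comm]
  have hdiff (x : ℕ) (hx : x = a ∨ x = b) :
      Interlaced y (T \ {k}) {c | c ∈ R.erase x} := by
    rw [herase]
    exact h.diff hkT hlow ha hak hb hkb ha' hb' hx
  have hstep : pairStep y imax (P, R) k =
      if |y k - y a| < |y k - y b| then ((a, k) :: P, R.erase a)
      else ((k, b) :: P, R.erase b) := by
    simp only [pairStep, hk0, hki, or_self, if_false, hamax, hbmin]
  rw [hstep, abs_of_nonneg (by linarith), abs_of_nonneg (by linarith)]
  split_ifs with hlt
  · refine ⟨a, ha, ?_, hdiff a (Or.inl rfl), _, Or.inl rfl, rfl⟩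
    rintro rfl
    linarith [hgle b hb]
  · refine ⟨b, hb, ?_, hdiff b (Or.inr rfl), _, Or.inr rfl, rfl⟩
    rintro rfl
    linarith [hglt a ha (by omega)]

open Classical in
/-- Running the algorithm on an interlaced configuration uses every peak and every valley other than
the global minimum `g` exactly once. -/
theorem foldl_pairStep_of_interlaced {y : ℕ → ℝ} {imax g : ℕ} :
    ∀ (T : List ℕ) (P : List (ℕ × ℕ)) (R : List ℕ), (∀ k ∈ T, k ≠ 0 ∧ k ≠ imax) →
      T.Nodup → T.Pairwise (fun k l => y k ≤ y l) → R.Nodup →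
      Interlaced y {k | k ∈ T} {a | a ∈ R} → g ∈ R → (∀ a ∈ R, y g ≤ y a) →
      (∀ a ∈ R, a < g → y g < y a) →
      let Q := (T.foldl (pairStep y imax) (P, R)).1
      Q.length = P.length + T.length ∧
      (∀ v, (Q.filter fun p => decide (p.1 = v ∨ p.2 = v)).length =
        (P.filter fun p => decide (p.1 = v ∨ p.2 = v)).length +
          if v ∈ T ∨ (v ∈ R ∧ v ≠ g) then 1 else 0) ∧
      ∀ p ∈ Q, p ∈ P ∨ (p.1 ∈ T ∧ p.2 ∈ R) ∨ (p.1 ∈ R ∧ p.2 ∈ T)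
  | [], P, R, _, _, _, _, h, hg, _, _ => by
    have hsingle : ∀ v ∈ R, v = g := by
      intro v hv
      by_contra hne
      rcases lt_or_gt_of_ne hne with hlt | hlt
      · obtain ⟨k, hk, -⟩ := h.peak_between v hv g hg hlt
        simp at hk
      · obtain ⟨k, hk, -⟩ := h.peak_between g hg v hv hlt
        simp at hk
    refine ⟨by simp, fun v => ?_, fun p hp => Or.inl hp⟩
    have : ¬ (v ∈ R ∧ v ≠ g) := fun hv => hv.2 (hsingle v hv.1)
    simp [this]
  | k :: T, P, R, hT, hnd, hs, hR, h, hg, hgle, hglt => by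
    rw [List.nodup_cons] at hnd
    rw [List.pairwise_cons] at hs
    obtain ⟨hk0, hki⟩ := hT k List.mem_cons_self
    obtain ⟨x, hx, hxg, hI, p, hp, hstep⟩ := pairStep_of_interlaced (P := P) (g := g) hk0 hki hR
      (T := {l | l ∈ k :: T}) List.mem_cons_self
      (by intro l hl
          rcases List.mem_cons.1 hl with rfl | hl
          · exact le_rfl
          · exact hs.1 l hl) h hgle hglt
    have hset : {l | l ∈ k :: T} \ {k} = {l | l ∈ T} := by
      ext l
      have := hnd.1
      simp only [Set.mem_sdiff, Set.mem_ofPred_eq, Set.mem_singleton_iff, List.mem_cons]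
      grind
    rw [hset] at hI
    have hsub : ∀ a ∈ R.erase x, a ∈ R := fun a ha => List.mem_of_mem_erase ha
    have hkR : k ∉ R := h.notMem k List.mem_cons_self
    have hTR : ∀ l ∈ T, l ∉ R := fun l hl => h.notMem l (List.mem_cons_of_mem _ hl)
    obtain ⟨ih1, ih2, ih3⟩ := foldl_pairStep_of_interlaced T (p :: P) (R.erase x)
      (fun l hl => hT l (List.mem_cons_of_mem _ hl)) hnd.2 hs.2 (hR.erase x) hI
      ((List.mem_erase_of_ne hxg.symm).2 hg) (fun a ha => hgle a (hsub a ha))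
      (fun a ha => hglt a (hsub a ha))
    simp only [List.foldl_cons, hstep]
    refine ⟨by rw [ih1]; simp; omega, fun v => ?_, fun q hq => ?_⟩
    · rw [ih2 v, List.filter_cons]
      have hpv : (p.1 = v ∨ p.2 = v) ↔ (v = k ∨ v = x) := by
        rcases hp with rfl | rfl <;> grind
      simp only [hpv, decide_eq_true_eq, List.mem_cons, hR.mem_erase_iff]
      have := hnd.1
      have := hTR v
      grind
    · rcases ih3 q hq with hq | hq | hq
      · rcases List.mem_cons.1 hq with rfl | hq
        · rcases hp with rfl | rfl
          · exact Or.inr (Or.inr ⟨hx, List.mem_cons_self⟩)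
          · exact Or.inr (Or.inl ⟨List.mem_cons_self, hx⟩)
        · exact Or.inl hq
      · exact Or.inr (Or.inl ⟨List.mem_cons_of_mem _ hq.1, hsub _ hq.2⟩)
      · exact Or.inr (Or.inr ⟨hsub _ hq.1, List.mem_cons_of_mem _ hq.2⟩)

theorem foldl_pairStep_filter (y : ℕ → ℝ) (imax : ℕ) (T : List ℕ) (s : List (ℕ × ℕ) × List ℕ) :
    (T.filter fun k => decide (k ≠ 0 ∧ k ≠ imax)).foldl (pairStep y imax) s =
      T.foldl (pairStep y imax) s := by
  induction T generalizing s with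
  | nil => rfl
  | cons k T ih =>
    by_cases hk : k ≠ 0 ∧ k ≠ imax
    · rw [List.filter_cons_of_pos (by simpa using hk), List.foldl_cons, List.foldl_cons, ih]
    · have hstep : pairStep y imax s k = s := by
        rw [pairStep, if_pos (by tauto)]
      rw [List.filter_cons_of_neg (by simpa using hk), List.foldl_cons, hstep, ih]

theorem mem_minKnotList {m : ℕ} {y : ℕ → ℝ} {l : ℕ} :
    l ∈ minKnotList m y ↔ IsLocalMinKnot m y l := by
  simp only [minKnotList, List.mem_filter, List.mem_range, decide_eq_true_eq, and_iff_right_iff_imp]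
  intro h
  have := ((isLocalMinKnot_iff m y l).1 h).1
  omega

theorem mem_maxKnotList {m : ℕ} {y : ℕ → ℝ} {l : ℕ} :
    l ∈ maxKnotList m y ↔ IsLocalMaxKnot m y l := by
  simp only [maxKnotList, List.mem_filter, List.mem_range, decide_eq_true_eq, and_iff_right_iff_imp]
  intro h
  have := ((isLocalMaxKnot_iff m y l).1 h).1
  omega

theorem nodup_minKnotList (m : ℕ) (y : ℕ → ℝ) : (minKnotList m y).Nodup :=
  List.nodup_range.filter _

theorem nodup_maxKnotList (m : ℕ) (y : ℕ → ℝ) : (maxKnotList m y).Nodup :=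
  List.nodup_range.filter _

theorem sortedMaxKnots_perm (m : ℕ) (y : ℕ → ℝ) : (sortedMaxKnots m y).Perm (maxKnotList m y) :=
  List.mergeSort_perm _ _

theorem pairwise_sortedMaxKnots (m : ℕ) (y : ℕ → ℝ) :
    (sortedMaxKnots m y).Pairwise fun k l => y k ≤ y l := by
  classical
  have := List.pairwise_mergeSort (le := fun a b => decide (y a < y b ∨ (y a = y b ∧ a ≤ b)))
    (by intro a b c hab hbc
        simp only [decide_eq_true_eq] at *
        grind)
    (by intro a b
        simp only [Bool.or_eq_true, decide_eq_true_eq]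
        grind) (maxKnotList m y)
  refine List.Pairwise.imp ?_ this
  intro a b h
  simp only [decide_eq_true_eq] at h
  grind

theorem imaxKnot_spec {m : ℕ} {y : ℕ → ℝ} {k : ℕ}
    (hk : IsLocalMinKnot m y k ∨ IsLocalMaxKnot m y k) :
    k ≤ imaxKnot m y ∧
      (IsLocalMinKnot m y (imaxKnot m y) ∨ IsLocalMaxKnot m y (imaxKnot m y)) := by
  have hmem : k ∈ minKnotList m y ++ maxKnotList m y := by
    rwa [List.mem_append, mem_minKnotList, mem_maxKnotList]
  cases hm : (minKnotList m y ++ maxKnotList m y).max? with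
  | none =>
    rw [List.max?_eq_none_iff] at hm
    simp [hm] at hmem
  | some b =>
    have hb : imaxKnot m y = b := by simp [imaxKnot, hm]
    rw [List.max?_eq_some_iff, List.mem_append, mem_minKnotList, mem_maxKnotList] at hm
    rw [hb]
    exact ⟨hm.2 k hmem, hm.1⟩

theorem interlaced_knots (m : ℕ) (y : ℕ → ℝ) :
    Interlaced y {k | IsLocalMaxKnot m y k ∧ k ≠ 0 ∧ k ≠ imaxKnot m y}
      {a | IsLocalMinKnot m y a} where
  notMem k hk := hk.1.not_isLocalMinKnot
  exists_lt k hk := by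
    obtain ⟨h1, -, h2, -⟩ := (isLocalMaxKnot_iff m y k).1 hk.1
    have := hk.2.1
    obtain ⟨l, -, hl, hmin, -⟩ := exists_isLocalMinKnot (i := 0) (p := k - 1) (Nat.zero_le _)
      (Nat.sub_le k 1) h1 (h2 (by omega)) (Or.inl rfl)
    exact ⟨l, hmin, hl⟩
  exists_gt k hk := by
    obtain ⟨hle, hmin | hmax⟩ := imaxKnot_spec (Or.inr hk.1)
    · exact ⟨_, hmin, lt_of_le_of_ne hle hk.2.2⟩
    · obtain ⟨l, h1, -, h2⟩ :=
        exists_isLocalMinKnot_between_max (lt_of_le_of_ne hle hk.2.2) hk.1 hmax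
      exact ⟨l, h2, h1⟩
  peak_between a ha b hb hab := by
    obtain ⟨l, h1, h2, h3⟩ := exists_isLocalMaxKnot_between_min hab ha hb
    have := (imaxKnot_spec (Or.inl hb)).1
    exact ⟨l, ⟨h3, by omega, by omega⟩, h1, h2⟩
  valley_between k hk l hl hkl := by
    obtain ⟨c, h1, h2, h3⟩ := exists_isLocalMinKnot_between_max hkl hk.1 hl.1
    exact ⟨c, h3, h1, h2⟩
  le a ha k hk h := ha.le_of_forall_not_between hk.1 h

theorem length_le_length_filter_ne_add_two {l : List ℕ} (hl : l.Nodup) (a b : ℕ) :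
    l.length ≤ (l.filter fun k => decide (k ≠ a ∧ k ≠ b)).length + 2 := by
  have h1 := List.toFinset_card_of_nodup hl
  have h2 := List.toFinset_card_of_nodup (hl.filter fun k => decide (k ≠ a ∧ k ≠ b))
  have h3 : l.toFinset ⊆ (l.filter fun k => decide (k ≠ a ∧ k ≠ b)).toFinset ∪ {a, b} := by
    intro k hk
    simp only [Finset.mem_union, List.mem_toFinset, List.mem_filter, decide_eq_true_eq,
      Finset.mem_insert, Finset.mem_singleton] at hk ⊢
    tauto
  have h4 := Finset.card_le_card h3
  have h5 := Finset.card_union_le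
    (l.filter fun k => decide (k ≠ a ∧ k ≠ b)).toFinset ({a, b} : Finset ℕ)
  have h6 := Finset.card_le_two (a := a) (b := b)
  omega

theorem lt_of_argmin_minKnotList {m : ℕ} {y : ℕ → ℝ} {g a : ℕ}
    (hg : (minKnotList m y).argmin y = some g) (ha : a ∈ minKnotList m y) (hag : a < g) :
    y g < y a := by
  rw [List.argmin_eq_some_iff] at hg
  obtain ⟨hgm, hle, hidx⟩ := hg
  refine lt_of_le_of_ne (hle a ha) fun heq => ?_
  have hi := hidx a ha heq.ge
  have hsorted : (minKnotList m y).Pairwise (· < ·) := List.pairwise_lt_range.filter _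
  have h1 := List.idxOf_lt_length_iff.2 hgm
  have h2 := List.idxOf_lt_length_iff.2 ha
  rcases hi.lt_or_eq with hlt | heq
  · have := List.pairwise_iff_getElem.1 hsorted _ _ h1 h2 hlt
    rw [List.getElem_idxOf, List.getElem_idxOf] at this
    omega
  · have := (List.idxOf_inj hgm).1 heq
    omega

open Classical in
/-- Algorithm 2 produces at least `#Y^m - 2` persistence pairs; each local
maximum knot not lying in `{x_0, x_max}` is paired with exactly one local minimum knot,
each local minimum knot that is not the global minimum knot occurs in exactly one
persistence pair, and the global minimum knot remains unpaired. -/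
theorem algorithm2_pairing_properties (m : ℕ) (y : ℕ → ℝ) :
    (((maxKnotList m y).length : ℤ) - 2 ≤ ((pairsP1 m y).length : ℤ)) ∧
    (∀ k ∈ maxKnotList m y, k ≠ 0 → k ≠ imaxKnot m y →
      ((pairsP1 m y).filter fun p => decide (p.1 = k ∨ p.2 = k)).length = 1 ∧
      ∀ p ∈ pairsP1 m y,
        (p.1 = k → p.2 ∈ minKnotList m y) ∧ (p.2 = k → p.1 ∈ minKnotList m y)) ∧
    (∀ k ∈ minKnotList m y, (minKnotList m y).argmin y ≠ some k →
      ((pairsP1 m y).filter fun p => decide (p.1 = k ∨ p.2 = k)).length = 1) ∧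
    (∀ g : ℕ, (minKnotList m y).argmin y = some g →
      ∀ p ∈ pairsP1 m y, p.1 ≠ g ∧ p.2 ≠ g) := by
  set T := (sortedMaxKnots m y).filter fun k => decide (k ≠ 0 ∧ k ≠ imaxKnot m y) with hTdef
  have hP : pairsP1 m y = (T.foldl (pairStep y (imaxKnot m y)) ([], minKnotList m y)).1 := by
    rw [hTdef, foldl_pairStep_filter, pairsP1]
  have hTmem : ∀ k, k ∈ T ↔ IsLocalMaxKnot m y k ∧ k ≠ 0 ∧ k ≠ imaxKnot m y := by
    intro k
    rw [hTdef, List.mem_filter, (sortedMaxKnots_perm m y).mem_iff, mem_maxKnotList,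
      decide_eq_true_eq]
  have hnd : (sortedMaxKnots m y).Nodup :=
    (sortedMaxKnots_perm m y).nodup_iff.2 (nodup_maxKnotList m y)
  have hlen : (maxKnotList m y).length ≤ T.length + 2 := by
    rw [← (sortedMaxKnots_perm m y).length_eq]
    exact length_le_length_filter_ne_add_two hnd 0 (imaxKnot m y)
  have hI : Interlaced y {k | k ∈ T} {a | a ∈ minKnotList m y} := by
    simp only [hTmem, mem_minKnotList]
    exact interlaced_knots m y
  cases hg : (minKnotList m y).argmin y with
  | none =>
    rw [List.argmin_eq_none] at hg
    have hT : T = [] := List.eq_nil_iff_forall_not_mem.2 fun k hk => by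
      obtain ⟨a, ha, -⟩ := hI.exists_lt k hk
      simp [hg] at ha
    rw [hT] at hlen hP
    simp only [List.length_nil] at hlen
    refine ⟨by omega, fun k hk h0 hi => ?_, fun k hk => by simp [hg] at hk, fun g h => by simp at h⟩
    have := (hTmem k).2 ⟨mem_maxKnotList.1 hk, h0, hi⟩
    simp [hT] at this
  | some g =>
    have hg' := List.argmin_eq_some_iff.1 hg
    obtain ⟨h1, h2, h3⟩ := foldl_pairStep_of_interlaced (g := g) T [] (minKnotList m y)
      (fun k hk => ((hTmem k).1 hk).2) (hnd.filter _) ((pairwise_sortedMaxKnots m y).filter _)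
      (nodup_minKnotList m y) hI hg'.1 hg'.2.1 fun a ha => lt_of_argmin_minKnotList hg ha
    rw [← hP] at h1 h2 h3
    simp only [List.filter_nil, List.length_nil, zero_add] at h1 h2
    have hdisj : ∀ k ∈ T, k ∉ minKnotList m y := hI.notMem
    refine ⟨by omega, fun k hk h0 hi => ?_, fun k hk hne => ?_, fun g' hg'' p hp => ?_⟩
    · have hkT := (hTmem k).2 ⟨mem_maxKnotList.1 hk, h0, hi⟩
      refine ⟨by rw [h2, if_pos (Or.inl hkT)], fun p hp => ?_⟩
      have hkR := hdisj k hkT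
      rcases h3 p hp with h | h | h
      · simp at h
      · exact ⟨fun _ => h.2, fun e => absurd (e ▸ h.2) hkR⟩
      · exact ⟨fun e => absurd (e ▸ h.1) hkR, fun _ => h.1⟩
    · rw [h2, if_pos (Or.inr ⟨hk, fun e => hne (by rw [e])⟩)]
    · obtain rfl : g = g' := Option.some.inj hg''
      have hgT : g ∉ T := fun h => hdisj g h hg'.1
      have hzero := h2 g
      rw [if_neg (by tauto), List.length_eq_zero_iff, List.filter_eq_nil_iff] at hzero
      simpa using hzero p hp
end

section
/- For every finite real sequence y = (y_0, ..., y_m) and every constant c ∈ ℝ, the persistence distance is positively homogeneous: ‖c·y‖_per = |c| · ‖y‖_per. -/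
theorem isLocalMinKnot_const_mul_iff (m : ℕ) (y : ℕ → ℝ) {c : ℝ} (hc : 0 < c) (l : ℕ) :
    IsLocalMinKnot m (fun i => c * y i) l ↔ IsLocalMinKnot m y l := by
  simp only [IsLocalMinKnot, gt_iff_lt, mul_lt_mul_iff_right₀ hc, mul_right_inj' hc.ne']

theorem isLocalMaxKnot_const_mul_iff (m : ℕ) (y : ℕ → ℝ) {c : ℝ} (hc : 0 < c) (l : ℕ) :
    IsLocalMaxKnot m (fun i => c * y i) l ↔ IsLocalMaxKnot m y l := by
  simp only [IsLocalMaxKnot, gt_iff_lt, mul_lt_mul_iff_right₀ hc, mul_right_inj' hc.ne']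

theorem minKnotList_const_mul (m : ℕ) (y : ℕ → ℝ) {c : ℝ} (hc : 0 < c) :
    minKnotList m (fun i => c * y i) = minKnotList m y :=
  List.filter_congr fun l _ => decide_eq_decide.2 (isLocalMinKnot_const_mul_iff m y hc l)

theorem maxKnotList_const_mul (m : ℕ) (y : ℕ → ℝ) {c : ℝ} (hc : 0 < c) :
    maxKnotList m (fun i => c * y i) = maxKnotList m y :=
  List.filter_congr fun l _ => decide_eq_decide.2 (isLocalMaxKnot_const_mul_iff m y hc l)

theorem sortedMaxKnots_const_mul (m : ℕ) (y : ℕ → ℝ) {c : ℝ} (hc : 0 < c) :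
    sortedMaxKnots m (fun i => c * y i) = sortedMaxKnots m y := by
  simp only [sortedMaxKnots, maxKnotList_const_mul m y hc, mul_lt_mul_iff_right₀ hc,
    mul_right_inj' hc.ne']

theorem imaxKnot_const_mul (m : ℕ) (y : ℕ → ℝ) {c : ℝ} (hc : 0 < c) :
    imaxKnot m (fun i => c * y i) = imaxKnot m y := by
  simp only [imaxKnot, minKnotList_const_mul m y hc, maxKnotList_const_mul m y hc]

theorem pairStep_const_mul (y : ℕ → ℝ) {c : ℝ} (hc : 0 < c) (n : ℕ) :
    pairStep (fun i => c * y i) n = pairStep y n := by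
  funext acc k
  simp only [pairStep, ← mul_sub, abs_mul, mul_lt_mul_iff_right₀ (abs_pos.2 hc.ne')]

theorem pairsP1_const_mul (m : ℕ) (y : ℕ → ℝ) {c : ℝ} (hc : 0 < c) :
    pairsP1 m (fun i => c * y i) = pairsP1 m y := by
  simp only [pairsP1, sortedMaxKnots_const_mul m y hc, imaxKnot_const_mul m y hc,
    minKnotList_const_mul m y hc, pairStep_const_mul y hc]

/-- the persistence distance is positively homogeneous:
`‖c • y‖_per = |c| * ‖y‖_per` for all `c ∈ ℝ`. -/
theorem perDist_smul (m : ℕ) (y : ℕ → ℝ) (c : ℝ) :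
    perDist m (fun i => c * y i) = |c| * perDist m y := by
  simp only [perDist, ← mul_sub, abs_mul, List.sum_map_mul_left]
  rw [← mul_add]
  rcases lt_trichotomy c 0 with hc | rfl | hc
  · have hpos : pairsP1 m (fun i => c * y i) = pairsP1 m fun i => -(y i) := by
      simpa only [neg_mul_neg] using pairsP1_const_mul m (fun i => -(y i)) (neg_pos.2 hc)
    have hneg : pairsP1 m (fun i => -(c * y i)) = pairsP1 m y := by
      simpa only [neg_mul] using pairsP1_const_mul m y (neg_pos.2 hc)
    rw [hpos, hneg, add_comm]
  · simp
  · have hneg : pairsP1 m (fun i => -(c * y i)) = pairsP1 m fun i => -(y i) := by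
      simpa only [mul_neg] using pairsP1_const_mul m (fun i => -(y i)) hc
    rw [pairsP1_const_mul m y hc, hneg]
end

section
/- The discrete total variation is submodular: for all y, z ∈ ℝ^{m+1}, TV(y) + TV(z) ≥ TV(max(y, z)) + TV(min(y, z)), where max(y, z) := (max{y_j, z_j})_{j=0}^m and min(y, z) := (min{y_j, z_j})_{j=0}^m are taken componentwise. -/
/-- Componentwise sorting of two pairs does not increase the sum of their distances. -/
theorem abs_max_sub_max_add_abs_min_sub_min_le (a b c d : ℝ) :
    |max a b - max c d| + |min a b - min c d| ≤ |a - c| + |b - d| := by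
  rcases le_total a b with h₁ | h₁ <;> rcases le_total c d with h₂ | h₂ <;>
    simp only [max_eq_left, max_eq_right, min_eq_left, min_eq_right, h₁, h₂] <;>
    grind [abs_cases]

/-- the discrete total variation is submodular:
`TV(y) + TV(z) ≥ TV(max(y,z)) + TV(min(y,z))` with componentwise maximum and minimum. -/
theorem discreteTV_submodular (m : ℕ) (y z : ℕ → ℝ) :
    discreteTV m (fun j => max (y j) (z j)) + discreteTV m (fun j => min (y j) (z j)) ≤
      discreteTV m y + discreteTV m z := by
  simp only [discreteTV, ← Finset.sum_add_distrib]
  exact Finset.sum_le_sum fun j _ => abs_max_sub_max_add_abs_min_sub_min_le _ _ _ _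
end
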